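/- Let d ≥ 1, let I₁, I₂ ⊂ ℝ^d be relatively separated sets, let δ₁, δ₂ ∈ (0,1], and let 𝒜₁ = 𝒮¹_{δ₁}(I₁) and 𝒜₂ = 𝒮¹_{δ₂}(I₂) be the corresponding weighted Schur algebras. Then 𝒜 = Ã₁ ∩ Ã₂ is inverse-closed: if A ∈ 𝒜 acts as a boundedly invertible operator on ℓ²(I₁×I₂), then the rank-four tensor whose entry B_{i,k,n,m} equals the ((i,k),(m,n)) matrix entry of A⁻¹ also belongs to 𝒜. -/

import Mathlib

open scoped ComplexConjugate

noncomputable section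

namespace PaperTensor

variable {I I₁ I₂ : Type*}

/-- The space `ℓ²(I)`. -/
abbrev L2 (I : Type*) := lp (fun _ : I => ℂ) 2

/-- The continuous linear map `T` represents the matrix `M` as an operator on `ℓ²(I)`,
i.e. `(T c) k = Σ_l M k l * c l` for every `c ∈ ℓ²(I)`. -/
def Represents (M : I → I → ℂ) (T : L2 I →L[ℂ] L2 I) : Prop :=
  ∀ c : L2 I, ∀ k : I, HasSum (fun l : I => M k l * (c : ∀ _ : I, ℂ) l) ((T c : ∀ _ : I, ℂ) k)

/-- `M` defines a bounded operator on `ℓ²(I)`. -/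
def Bounded2 (M : I → I → ℂ) : Prop := ∃ T : L2 I →L[ℂ] L2 I, Represents M T

/-- The operator norm `‖M‖_{B(ℓ²(I))}` of the matrix `M` (junk value `0` if `M` is unbounded). -/
noncomputable def opNorm2 (M : I → I → ℂ) : ℝ :=
  letI : Decidable (Bounded2 M) := Classical.propDecidable _
  if h : Bounded2 M then ‖h.choose‖ else 0

/-- The matrix product of two infinite matrices. -/
noncomputable def matMul (A B : I → I → ℂ) : I → I → ℂ :=
  fun i j => ∑' m : I, A i m * B m j

/-- The conjugate transpose of a matrix. -/
def conjTranspose (A : I → I → ℂ) : I → I → ℂ := fun i j => conj (A j i)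

/-- A solid Banach algebra of (infinite) matrices over the index set `I`. -/
structure SolidBanachAlgebra (I : Type*) where
  carrier : Set (I → I → ℂ)
  anorm : (I → I → ℂ) → ℝ
  zero_mem : (0 : I → I → ℂ) ∈ carrier
  add_mem : ∀ A B : I → I → ℂ, A ∈ carrier → B ∈ carrier → A + B ∈ carrier
  smul_mem : ∀ (c : ℂ) (A : I → I → ℂ), A ∈ carrier → c • A ∈ carrier
  mul_mem : ∀ A B : I → I → ℂ, A ∈ carrier → B ∈ carrier → matMul A B ∈ carrier
  anorm_nonneg : ∀ A ∈ carrier, 0 ≤ anorm A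
  anorm_zero : anorm 0 = 0
  anorm_eq_zero : ∀ A ∈ carrier, anorm A = 0 → A = 0
  anorm_smul : ∀ (c : ℂ), ∀ A ∈ carrier, anorm (c • A) = ‖c‖ * anorm A
  anorm_add : ∀ A ∈ carrier, ∀ B ∈ carrier, anorm (A + B) ≤ anorm A + anorm B
  anorm_mul : ∀ A ∈ carrier, ∀ B ∈ carrier, anorm (matMul A B) ≤ anorm A * anorm B
  complete : ∀ f : ℕ → (I → I → ℂ), (∀ n, f n ∈ carrier) →
      (∀ ε > (0 : ℝ), ∃ N : ℕ, ∀ m ≥ N, ∀ n ≥ N, anorm (f m - f n) < ε) →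
      ∃ A ∈ carrier, ∀ ε > (0 : ℝ), ∃ N : ℕ, ∀ n ≥ N, anorm (f n - A) < ε
  bounded : ∀ A ∈ carrier, Bounded2 A
  solid : ∀ A ∈ carrier, ∀ B : I → I → ℂ,
      (∀ i j, ‖B i j‖ ≤ ‖A i j‖) → B ∈ carrier ∧ anorm B ≤ anorm A

/-- A matrix algebra is involutive if it is closed under conjugate transposition and the
norm is invariant under it. -/
def SolidBanachAlgebra.Involutive (𝒜 : SolidBanachAlgebra I) : Prop :=
  ∀ A ∈ 𝒜.carrier, conjTranspose A ∈ 𝒜.carrier ∧ 𝒜.anorm (conjTranspose A) = 𝒜.anorm A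

/-- Rank-four tensors `(A_{i,k,l,j})` indexed by `I₁ × I₂² × I₁`. -/
abbrev Tensor (I₁ I₂ : Type*) := I₁ → I₂ → I₂ → I₁ → ℂ

/-- The restriction `A|_{{i} × I₂² × {j}}`, an `I₂ × I₂` matrix. -/
def res1 (A : Tensor I₁ I₂) (i j : I₁) : I₂ → I₂ → ℂ := fun k l => A i k l j

/-- The restriction `A|_{I₁ × {(k,l)} × I₁}`, an `I₁ × I₁` matrix. -/
def res2 (A : Tensor I₁ I₂) (k l : I₂) : I₁ → I₁ → ℂ := fun i j => A i k l j

/-- Membership in `Ã₁`, for a set `S` of `I₁ × I₁` matrices playing the role of `𝒜₁`: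
all restrictions `A|_{{i} × I₂² × {j}}` are bounded on `ℓ²(I₂)` and the matrix of their
operator norms belongs to `S`. -/
def MemT1 (S : Set (I₁ → I₁ → ℂ)) (A : Tensor I₁ I₂) : Prop :=
  (∀ i j : I₁, Bounded2 (res1 A i j)) ∧
    (fun i j : I₁ => (opNorm2 (res1 A i j) : ℂ)) ∈ S

/-- Membership in `Ã₂`. -/
def MemT2 (S : Set (I₂ → I₂ → ℂ)) (A : Tensor I₁ I₂) : Prop :=
  (∀ k l : I₂, Bounded2 (res2 A k l)) ∧
    (fun k l : I₂ => (opNorm2 (res2 A k l) : ℂ)) ∈ S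

/-- The norm `‖A‖_{Ã₁}` (meaningful on members of `Ã₁`). -/
noncomputable def normT1 (𝒜₁ : SolidBanachAlgebra I₁) (A : Tensor I₁ I₂) : ℝ :=
  𝒜₁.anorm (fun i j : I₁ => (opNorm2 (res1 A i j) : ℂ))

/-- The norm `‖A‖_{Ã₂}` (meaningful on members of `Ã₂`). -/
noncomputable def normT2 (𝒜₂ : SolidBanachAlgebra I₂) (A : Tensor I₁ I₂) : ℝ :=
  𝒜₂.anorm (fun k l : I₂ => (opNorm2 (res2 A k l) : ℂ))

/-- Membership in `𝒜 = Ã₁ ∩ Ã₂`. -/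
def MemA (𝒜₁ : SolidBanachAlgebra I₁) (𝒜₂ : SolidBanachAlgebra I₂) (A : Tensor I₁ I₂) : Prop :=
  MemT1 𝒜₁.carrier A ∧ MemT2 𝒜₂.carrier A

/-- The norm `‖A‖_𝒜 = max {‖A‖_{Ã₁}, ‖A‖_{Ã₂}}`. -/
noncomputable def normA (𝒜₁ : SolidBanachAlgebra I₁) (𝒜₂ : SolidBanachAlgebra I₂)
    (A : Tensor I₁ I₂) : ℝ :=
  max (normT1 𝒜₁ A) (normT2 𝒜₂ A)

/-- The matrix over `I₁ × I₂` through which a rank-four tensor acts on `ℓ²(I₁ × I₂)`: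
`(Ac)_{(i,k)} = Σ_{(m,n)} A_{i,k,n,m} c_{(m,n)}`. -/
def toMatrix (A : Tensor I₁ I₂) : (I₁ × I₂) → (I₁ × I₂) → ℂ :=
  fun p q => A p.1 p.2 q.2 q.1

/-- The rank-four tensor of matrix entries of an operator `T` on `ℓ²(I₁ × I₂)`:
its `(i,k,l,j)` entry is the `((i,k),(j,l))` matrix entry of `T`. -/
noncomputable def entryTensor (T : L2 (I₁ × I₂) →L[ℂ] L2 (I₁ × I₂)) : Tensor I₁ I₂ :=
  letI : DecidableEq (I₁ × I₂) := Classical.decEq _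
  fun i k l j => (T (lp.single 2 (j, l) (1 : ℂ)) : ∀ _ : I₁ × I₂, ℂ) (i, k)

/-- A set `S` of rank-four tensors is inverse-closed if, whenever `A ∈ S` acts as a boundedly
invertible operator on `ℓ²(I₁ × I₂)`, the rank-four tensor of matrix entries of the inverse
operator also belongs to `S`. -/
def InverseClosed (S : Set (Tensor I₁ I₂)) : Prop :=
  ∀ A ∈ S, ∀ T Tinv : L2 (I₁ × I₂) →L[ℂ] L2 (I₁ × I₂),
    Represents (toMatrix A) T →
    T.comp Tinv = ContinuousLinearMap.id ℂ (L2 (I₁ × I₂)) →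
    Tinv.comp T = ContinuousLinearMap.id ℂ (L2 (I₁ × I₂)) →
    entryTensor Tinv ∈ S

/-- The doubly contracted tensor product
`(A : B)_{i,k,l,j} = Σ_{n ∈ I₂} Σ_{m ∈ I₁} A_{i,k,n,m} B_{m,n,l,j}`. -/
noncomputable def contract (A B : Tensor I₁ I₂) : Tensor I₁ I₂ :=
  fun i k l j => ∑' n : I₂, ∑' m : I₁, A i k n m * B m n l j

/-- Absolute convergence of all series defining the doubly contracted tensor product. -/
def ContractSummable (A B : Tensor I₁ I₂) : Prop :=
  ∀ (i : I₁) (k l : I₂) (j : I₁),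
    Summable (fun nm : I₂ × I₁ => ‖A i k nm.1 nm.2 * B nm.2 nm.1 l j‖)

/-- The adjoint tensor `(A*)_{i,k,l,j} = conj (A_{j,l,k,i})`. -/
def adjT (A : Tensor I₁ I₂) : Tensor I₁ I₂ := fun i k l j => conj (A j l k i)



/-- A subset `I ⊂ ℝ^d` is relatively separated if the number of its points in any cube
`x + [0,1]^d` is uniformly bounded. -/
def RelSeparated {d : ℕ} (I : Set (EuclideanSpace ℝ (Fin d))) : Prop :=
  ∃ N : ℕ, ∀ x : EuclideanSpace ℝ (Fin d),
    (I ∩ {y | ∀ t : Fin d, y t ∈ Set.Icc (x t) (x t + 1)}).Finite ∧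
    (I ∩ {y | ∀ t : Fin d, y t ∈ Set.Icc (x t) (x t + 1)}).ncard ≤ N

/-- The Jaffard algebra `𝒥_s(I)`: matrices with `sup_{i,j} |A_{i,j}| (1+|i-j|)^s < ∞`. -/
def JaffardSet {d : ℕ} (I : Set (EuclideanSpace ℝ (Fin d))) (s : ℝ) :
    Set (↥I → ↥I → ℂ) :=
  {A | ∃ C : ℝ, ∀ i j : ↥I,
    ‖A i j‖ * (1 + ‖(i : EuclideanSpace ℝ (Fin d)) - (j : EuclideanSpace ℝ (Fin d))‖) ^ s ≤ C}

/-- The weighted Schur algebra `𝒮¹_δ(I)`: matrices whose weighted row and column sums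
are uniformly bounded. -/
def SchurSet {d : ℕ} (I : Set (EuclideanSpace ℝ (Fin d))) (δ : ℝ) :
    Set (↥I → ↥I → ℂ) :=
  {A | (∀ i : ↥I, Summable fun j : ↥I =>
          ‖A i j‖ * (1 + ‖(i : EuclideanSpace ℝ (Fin d)) - (j : EuclideanSpace ℝ (Fin d))‖) ^ δ) ∧
       (∀ j : ↥I, Summable fun i : ↥I =>
          ‖A i j‖ * (1 + ‖(i : EuclideanSpace ℝ (Fin d)) - (j : EuclideanSpace ℝ (Fin d))‖) ^ δ) ∧
       ∃ C : ℝ,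
        (∀ i : ↥I, (∑' j : ↥I,
          ‖A i j‖ * (1 + ‖(i : EuclideanSpace ℝ (Fin d)) - (j : EuclideanSpace ℝ (Fin d))‖) ^ δ) ≤ C) ∧
        (∀ j : ↥I, (∑' i : ↥I,
          ‖A i j‖ * (1 + ‖(i : EuclideanSpace ℝ (Fin d)) - (j : EuclideanSpace ℝ (Fin d))‖) ^ δ) ≤ C)}

/-- `ν : ℤ^d → [1,∞)` is an admissible weight: bounded below by `1`, sub-multiplicative,
symmetric, and satisfying the GRS condition. -/
def AdmissibleWeight {d : ℕ} (ν : (Fin d → ℤ) → ℝ) : Prop :=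
  (∀ x, 1 ≤ ν x) ∧
  (∀ x y, ν (x + y) ≤ ν x * ν y) ∧
  (∀ x, ν (-x) = ν x) ∧
  (∀ z : Fin d → ℤ, Filter.Tendsto (fun n : ℕ => (ν (n • z)) ^ ((n : ℝ)⁻¹))
    Filter.atTop (nhds 1))

/-- The Sjöstrand algebra `𝒞_ν` over `ℤ^d`:
matrices with `Σ_i sup_j |A_{j,j-i}| ν(i) < ∞`. -/
def SjostrandSet {d : ℕ} (ν : (Fin d → ℤ) → ℝ) :
    Set ((Fin d → ℤ) → (Fin d → ℤ) → ℂ) :=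
  {A | (∀ i : Fin d → ℤ, BddAbove (Set.range fun j : Fin d → ℤ => ‖A j (j - i)‖)) ∧
       Summable fun i : Fin d → ℤ => (⨆ j : Fin d → ℤ, ‖A j (j - i)‖) * ν i}


/-! ### Block decompositions and the weighted row norm -/

section Blocks

open scoped ENNReal NNReal
open ContinuousLinearMap Filter Topology

variable {ι H K : Type*} [NormedAddCommGroup H] [InnerProductSpace ℂ H] [CompleteSpace H]
  [NormedAddCommGroup K] [InnerProductSpace ℂ K] [CompleteSpace K]

/-- The coordinate maps of a decomposition of `H` into mutually orthogonal copies of `K`. -/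
structure IsBlockDecomposition (R : ι → H →L[ℂ] K) : Prop where
  enorm_le_one : ∀ i, ‖R i‖ₑ ≤ 1
  comp_adjoint_of_ne : ∀ i j, i ≠ j → R i ∘L adjoint (R j) = 0
  hasSum : ∀ x, HasSum (fun i => adjoint (R i) (R i x)) x

/-- The `(i,j)` block of the operator `T`. -/
def block (R : ι → H →L[ℂ] K) (T : H →L[ℂ] H) (i j : ι) : K →L[ℂ] K :=
  R i ∘L T ∘L adjoint (R j)

/-- The supremum of the `w`-weighted row sums of the matrix of block norms of `T`. -/
def rowNorm (R : ι → H →L[ℂ] K) (w : ι → ι → ℝ≥0∞) (T : H →L[ℂ] H) : ℝ≥0∞ :=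
  ⨆ i, ∑' j, ‖block R T i j‖ₑ * w i j

/-- A symmetric subadditive weight whose balls grow at most polynomially. -/
structure IsPolyGrowthWeight (w : ι → ι → ℝ≥0∞) : Prop where
  self : ∀ i, w i i = 1
  one_le : ∀ i j, 1 ≤ w i j
  symm : ∀ i j, w i j = w j i
  le_add : ∀ i m j, w i j ≤ w i m + w m j
  growth : ∃ C : ℝ≥0∞, C ≠ ∞ ∧ ∃ D : ℕ, ∀ τ : ℝ≥0, 1 ≤ τ → ∀ i,
    ({j | w i j ≤ τ}.encard : ℝ≥0∞) ≤ C * (τ : ℝ≥0∞) ^ D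

variable {R : ι → H →L[ℂ] K} {w : ι → ι → ℝ≥0∞}

lemma enorm_adjoint (T : H →L[ℂ] K) : ‖adjoint T‖ₑ = ‖T‖ₑ := by
  rw [← ofReal_norm, ← ofReal_norm, LinearIsometryEquiv.norm_map]

lemma enorm_comp_le {E F G : Type*} [NormedAddCommGroup E] [NormedSpace ℂ E]
    [NormedAddCommGroup F] [NormedSpace ℂ F] [NormedAddCommGroup G] [NormedSpace ℂ G]
    (S : F →L[ℂ] G) (T : E →L[ℂ] F) : ‖S ∘L T‖ₑ ≤ ‖S‖ₑ * ‖T‖ₑ := by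
  rw [← ofReal_norm, ← ofReal_norm, ← ofReal_norm, ← ENNReal.ofReal_mul (norm_nonneg _)]
  exact ENNReal.ofReal_le_ofReal (opNorm_comp_le S T)

lemma enorm_block_le (hR : IsBlockDecomposition R) (T : H →L[ℂ] H) (i j : ι) :
    ‖block R T i j‖ₑ ≤ ‖T‖ₑ := by
  calc ‖block R T i j‖ₑ ≤ ‖R i‖ₑ * (‖T‖ₑ * ‖adjoint (R j)‖ₑ) :=
        (enorm_comp_le _ _).trans (by gcongr; exact enorm_comp_le _ _)
    _ ≤ 1 * (‖T‖ₑ * 1) := by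
        rw [enorm_adjoint]
        gcongr
        exacts [hR.enorm_le_one i, hR.enorm_le_one j]
    _ = ‖T‖ₑ := by simp

lemma block_adjoint (T : H →L[ℂ] H) (i j : ι) :
    block R (adjoint T) i j = adjoint (block R T j i) := by
  simp [block, adjoint_comp, comp_assoc]

lemma enorm_block_mul_le (hR : IsBlockDecomposition R) (S T : H →L[ℂ] H) (i j : ι) :
    ‖block R (S * T) i j‖ₑ ≤ ∑' m, ‖block R S i m‖ₑ * ‖block R T m j‖ₑ := by
  have key (x : K) : ‖block R (S * T) i j x‖ₑ ≤
      (∑' m, ‖block R S i m‖ₑ * ‖block R T m j‖ₑ) * ‖x‖ₑ := by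
    have h := (hR.hasSum (T (adjoint (R j) x))).mapL (R i ∘L S)
    have e : block R (S * T) i j x = ∑' m, block R S i m (block R T m j x) := h.tsum_eq.symm
    rw [e, ← ENNReal.tsum_mul_right]
    refine enorm_tsum_le_tsum_enorm.trans (ENNReal.tsum_le_tsum fun m => ?_)
    calc _ ≤ ‖block R S i m‖ₑ * ‖block R T m j x‖ₑ := le_opENorm _ _
      _ ≤ ‖block R S i m‖ₑ * (‖block R T m j‖ₑ * ‖x‖ₑ) := by gcongr; exact le_opENorm _ _
      _ = _ := (mul_assoc _ _ _).symm
  by_cases htop : ∑' m, ‖block R S i m‖ₑ * ‖block R T m j‖ₑ = ∞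
  · simp [htop]
  rw [← ENNReal.coe_toNNReal htop] at key ⊢
  rw [enorm_eq_nnnorm, ENNReal.coe_le_coe]
  refine opNNNorm_le_bound _ _ fun x => ?_
  have := key x
  rwa [enorm_eq_nnnorm, enorm_eq_nnnorm, ← ENNReal.coe_mul, ENNReal.coe_le_coe] at this

lemma tsum_row_le (w : ι → ι → ℝ≥0∞) (T : H →L[ℂ] H) (i : ι) :
    ∑' j, ‖block R T i j‖ₑ * w i j ≤ rowNorm R w T :=
  le_iSup (fun i => ∑' j, ‖block R T i j‖ₑ * w i j) i

lemma tsum_row_one_le (T : H →L[ℂ] H) (i : ι) :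
    ∑' j, ‖block R T i j‖ₑ ≤ rowNorm R 1 T := by
  simpa using tsum_row_le (R := R) 1 T i

lemma rowNorm_mul_le (hR : IsBlockDecomposition R) (hw : IsPolyGrowthWeight w)
    (S T : H →L[ℂ] H) :
    rowNorm R w (S * T) ≤ rowNorm R w S * rowNorm R 1 T + rowNorm R 1 S * rowNorm R w T := by
  refine iSup_le fun i => ?_
  calc ∑' j, ‖block R (S * T) i j‖ₑ * w i j
      ≤ ∑' j, ∑' m, (‖block R S i m‖ₑ * w i m * ‖block R T m j‖ₑ
          + ‖block R S i m‖ₑ * (‖block R T m j‖ₑ * w m j)) := by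
        refine ENNReal.tsum_le_tsum fun j => ?_
        calc _ ≤ (∑' m, ‖block R S i m‖ₑ * ‖block R T m j‖ₑ) * w i j := by
              gcongr; exact enorm_block_mul_le hR S T i j
          _ = ∑' m, ‖block R S i m‖ₑ * ‖block R T m j‖ₑ * w i j := ENNReal.tsum_mul_right.symm
          _ ≤ _ := ENNReal.tsum_le_tsum fun m => by
              calc _ ≤ ‖block R S i m‖ₑ * ‖block R T m j‖ₑ * (w i m + w m j) := by
                    gcongr; exact hw.le_add i m j
                _ = _ := by ring
    _ = ∑' m, (‖block R S i m‖ₑ * w i m * ∑' j, ‖block R T m j‖ₑ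
          + ‖block R S i m‖ₑ * ∑' j, ‖block R T m j‖ₑ * w m j) := by
        rw [ENNReal.tsum_comm]
        simp_rw [ENNReal.tsum_add, ENNReal.tsum_mul_left]
    _ ≤ ∑' m, (‖block R S i m‖ₑ * w i m * rowNorm R 1 T
          + ‖block R S i m‖ₑ * rowNorm R w T) := by
        gcongr with m
        exacts [tsum_row_one_le T m, tsum_row_le w T m]
    _ = (∑' m, ‖block R S i m‖ₑ * w i m) * rowNorm R 1 T
          + (∑' m, ‖block R S i m‖ₑ) * rowNorm R w T := by
        rw [ENNReal.tsum_add, ENNReal.tsum_mul_right, ENNReal.tsum_mul_right]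
    _ ≤ _ := by
        gcongr
        exacts [tsum_row_le w S i, tsum_row_one_le S i]

lemma rowNorm_one_le (hw : IsPolyGrowthWeight w) (T : H →L[ℂ] H) :
    rowNorm R 1 T ≤ rowNorm R w T := by
  refine iSup_mono fun i => ENNReal.tsum_le_tsum fun j => ?_
  gcongr
  exact hw.one_le i j

lemma rowNorm_mul_le_two (hR : IsBlockDecomposition R) (hw : IsPolyGrowthWeight w)
    (S T : H →L[ℂ] H) :
    rowNorm R w (S * T) ≤ 2 * (rowNorm R w S * rowNorm R w T) := by
  refine (rowNorm_mul_le hR hw S T).trans ?_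
  rw [two_mul]
  gcongr
  exacts [rowNorm_one_le hw T, rowNorm_one_le hw S]

lemma rowNorm_add_le (S T : H →L[ℂ] H) :
    rowNorm R w (S + T) ≤ rowNorm R w S + rowNorm R w T := by
  refine iSup_le fun i => ?_
  calc ∑' j, ‖block R (S + T) i j‖ₑ * w i j
      ≤ ∑' j, (‖block R S i j‖ₑ * w i j + ‖block R T i j‖ₑ * w i j) := by
        refine ENNReal.tsum_le_tsum fun j => ?_
        rw [← add_mul]
        gcongr
        have : block R (S + T) i j = block R S i j + block R T i j := by
          ext x; simp [block]
        rw [this]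
        exact enorm_add_le _ _
    _ ≤ _ := by
        rw [ENNReal.tsum_add]
        gcongr
        exacts [tsum_row_le w S i, tsum_row_le w T i]

lemma rowNorm_smul (c : ℂ) (T : H →L[ℂ] H) :
    rowNorm R w (c • T) = ‖c‖ₑ * rowNorm R w T := by
  simp only [rowNorm, ENNReal.mul_iSup, ← ENNReal.tsum_mul_left, ← mul_assoc]
  congr! 5 with i j
  have : block R (c • T) i j = c • block R T i j := by ext x; simp [block]
  rw [this, enorm_smul]

lemma rowNorm_id_le (hR : IsBlockDecomposition R) (hw : IsPolyGrowthWeight w) :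
    rowNorm R w 1 ≤ 1 := by
  refine iSup_le fun i => ?_
  rw [tsum_eq_single i fun j hj => ?_]
  · rw [hw.self, mul_one]
    exact (enorm_block_le hR 1 i i).trans
      (by rw [← ofReal_norm]; exact ENNReal.ofReal_le_one.2 norm_id_le)
  · have : block R 1 i j = 0 := hR.comp_adjoint_of_ne i j hj.symm
    simp [this]

lemma rowNorm_one_le_growth (hR : IsBlockDecomposition R) {C : ℝ≥0∞} {D : ℕ}
    (hC : ∀ τ : ℝ≥0, 1 ≤ τ → ∀ i, ({j | w i j ≤ τ}.encard : ℝ≥0∞) ≤ C * (τ : ℝ≥0∞) ^ D)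
    {τ : ℝ≥0} (hτ : 1 ≤ τ) (T : H →L[ℂ] H) :
    rowNorm R 1 T ≤ C * (τ : ℝ≥0∞) ^ D * ‖T‖ₑ + (τ : ℝ≥0∞)⁻¹ * rowNorm R w T := by
  classical
  refine iSup_le fun i => ?_
  have hτ0 : (τ : ℝ≥0∞) ≠ 0 := by simpa using (zero_lt_one.trans_le hτ).ne'
  calc ∑' j, ‖block R T i j‖ₑ * (1 : ι → ι → ℝ≥0∞) i j
      ≤ ∑' j, ({j | w i j ≤ τ}.indicator (fun _ => ‖T‖ₑ) j
          + (τ : ℝ≥0∞)⁻¹ * (‖block R T i j‖ₑ * w i j)) := by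
        refine ENNReal.tsum_le_tsum fun j => ?_
        by_cases h : w i j ≤ τ
        · rw [Set.indicator_of_mem (by exact h)]
          simpa using (enorm_block_le hR T i j).trans le_self_add
        · rw [Set.indicator_of_notMem (by exact h), zero_add]
          calc ‖block R T i j‖ₑ * 1 = ‖block R T i j‖ₑ * ((τ : ℝ≥0∞)⁻¹ * τ) := by
                rw [ENNReal.inv_mul_cancel hτ0 ENNReal.coe_ne_top]
            _ ≤ ‖block R T i j‖ₑ * ((τ : ℝ≥0∞)⁻¹ * w i j) := by
                gcongr; exact (not_le.1 h).le
            _ = _ := by ring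
    _ = ({j | w i j ≤ τ}.encard : ℝ≥0∞) * ‖T‖ₑ
          + (τ : ℝ≥0∞)⁻¹ * ∑' j, ‖block R T i j‖ₑ * w i j := by
        rw [ENNReal.tsum_add, ENNReal.tsum_mul_left, ← tsum_subtype, ENNReal.tsum_set_const]
    _ ≤ _ := by
        gcongr
        exacts [hC τ hτ i, tsum_row_le w T i]

lemma rowNorm_tsum_le {T : ℕ → H →L[ℂ] H} (hT : Summable T) :
    rowNorm R w (∑' n, T n) ≤ ∑' n, rowNorm R w (T n) := by
  refine iSup_le fun i => ?_
  calc ∑' j, ‖block R (∑' n, T n) i j‖ₑ * w i j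
      ≤ ∑' j, ∑' n, ‖block R (T n) i j‖ₑ * w i j := by
        refine ENNReal.tsum_le_tsum fun j => ?_
        rw [ENNReal.tsum_mul_right]
        gcongr
        have e : block R (∑' n, T n) i j = ∑' n, block R (T n) i j := by
          have h1 := hT.hasSum.mapL ((compL ℂ H H K (R i)) ∘L ((compL ℂ H H H).flip 1))
          have h2 := h1.mapL ((compL ℂ K H K).flip (adjoint (R j)))
          exact h2.tsum_eq.symm
        rw [e]
        exact enorm_tsum_le_tsum_enorm
    _ = ∑' n, ∑' j, ‖block R (T n) i j‖ₑ * w i j := ENNReal.tsum_comm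
    _ ≤ _ := ENNReal.tsum_le_tsum fun n => tsum_row_le w (T n) i

lemma tsum_ne_top_of_submultiplicative {f : ℕ → ℝ≥0∞} (h0 : f 0 ≠ ∞) (h1 : f 1 ≠ ∞)
    (hmul : ∀ m n, f (m + n) ≤ f m * f n) {m : ℕ} (hm : m ≠ 0) (hlt : f m < 1) :
    ∑' n, f n ≠ ∞ := by
  have : NeZero m := ⟨hm⟩
  have hfin (n : ℕ) : f n ≠ ∞ := by
    induction n with
    | zero => exact h0
    | succ n ih => exact ne_top_of_le_ne_top (ENNReal.mul_ne_top ih h1) (hmul n 1)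
  have hpow (q r : ℕ) : f (r + m * q) ≤ f m ^ q * f r := by
    induction q with
    | zero => simp
    | succ q ih =>
      calc f (r + m * (q + 1)) = f (m + (r + m * q)) := by congr 1; ring
        _ ≤ f m * f (r + m * q) := hmul _ _
        _ ≤ f m * (f m ^ q * f r) := by gcongr
        _ = _ := by ring
  refine ne_top_of_le_ne_top (b := (1 - f m)⁻¹ * ∑ r : Fin m, f r) ?_ ?_
  · refine ENNReal.mul_ne_top (ENNReal.inv_ne_top.2 (tsub_pos_of_lt hlt).ne') ?_
    exact ENNReal.sum_ne_top.2 fun r _ => hfin r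
  · rw [← (Nat.divModEquiv m).symm.tsum_eq f, ENNReal.tsum_prod', ← ENNReal.tsum_geometric,
      ← ENNReal.tsum_mul_right]
    refine ENNReal.tsum_le_tsum fun q => ?_
    rw [tsum_fintype, Finset.mul_sum]
    refine Finset.sum_le_sum fun r _ => ?_
    have : (Nat.divModEquiv m).symm (q, r) = r + m * q := by
      simp [Nat.divModEquiv, mul_comm, add_comm]
    rw [this]
    exact hpow q r

lemma exists_lt_one_of_quadratic_bound {f : ℕ → ℝ≥0∞} {c s : ℝ≥0∞} (h0 : f 0 ≠ ∞) (hc : c ≠ ∞)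
    (hc1 : 1 ≤ c) (hs : s < 1)
    (h : ∀ k, 1 ≤ f k → f (k + 1) ≤ c * (s ^ 2) ^ 2 ^ k * f k ^ 2) : ∃ k, f k < 1 := by
  by_contra! hf
  have key (k : ℕ) : c * f k ≤ (c * f 0 * s ^ k) ^ 2 ^ k := by
    induction k with
    | zero => simp
    | succ k ih =>
      calc c * f (k + 1) ≤ c * (c * (s ^ 2) ^ 2 ^ k * f k ^ 2) := by gcongr; exact h k (hf k)
        _ = (c * f k) ^ 2 * (s ^ 2) ^ 2 ^ k := by ring
        _ ≤ ((c * f 0 * s ^ k) ^ 2 ^ k) ^ 2 * (s ^ 2) ^ 2 ^ k := by gcongr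
        _ = _ := by rw [← pow_mul, ← pow_mul, ← pow_succ, ← pow_succ', ← mul_pow]; ring
  have hlim : Tendsto (fun k => c * f 0 * s ^ k) atTop (𝓝 (c * f 0 * 0)) :=
    ENNReal.Tendsto.const_mul (ENNReal.tendsto_pow_atTop_nhds_zero_of_lt_one hs)
      (Or.inr (ENNReal.mul_ne_top hc h0))
  rw [mul_zero] at hlim
  obtain ⟨k, hk⟩ := (hlim.eventually_lt_const zero_lt_one).exists
  have h1 : 1 ≤ c * f k := one_le_mul hc1 (hf k)
  exact absurd (h1.trans (key k)) (not_le.2 (pow_lt_one' hk (by positivity)))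

lemma exists_one_lt_pow_mul_le_one {q : ℝ≥0} (hq : q < 1) (n : ℕ) :
    ∃ u : ℝ≥0, 1 < u ∧ u ^ n * q ≤ 1 := by
  have hcont : Tendsto (fun u : ℝ≥0 => u ^ n * q) (𝓝[>] 1) (𝓝 (1 ^ n * q)) :=
    ((continuous_pow n).mul continuous_const).continuousAt.mono_left nhdsWithin_le_nhds
  have h1 : ∀ᶠ u in 𝓝[>] (1 : ℝ≥0), u ^ n * q < 1 :=
    hcont.eventually_lt_const (by simpa using hq)
  obtain ⟨u, hu, hu1⟩ := (h1.and self_mem_nhdsWithin).exists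
  exact ⟨u, hu1, hu.le⟩

lemma rowNorm_geom_series_ne_top (hR : IsBlockDecomposition R) (hw : IsPolyGrowthWeight w)
    {B : H →L[ℂ] H} (hB : ‖B‖ < 1) (hBw : rowNorm R w B ≠ ∞) :
    rowNorm R w (∑' n : ℕ, B ^ n) ≠ ∞ := by
  obtain ⟨C, hCtop, D, hC⟩ := hw.growth
  obtain ⟨u, hu1, huq⟩ := exists_one_lt_pow_mul_le_one (q := ‖B‖₊) hB (2 * D + 2)
  set f : ℕ → ℝ≥0∞ := fun n => 2 * rowNorm R w (B ^ n) with hf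
  have hmul (m n : ℕ) : f (m + n) ≤ f m * f n := by
    simp only [hf, pow_add]
    calc _ ≤ 2 * (2 * (rowNorm R w (B ^ m) * rowNorm R w (B ^ n))) := by
          gcongr; exact rowNorm_mul_le_two hR hw _ _
      _ = _ := by ring
  have h0 : f 0 ≠ ∞ := by
    simp only [hf, pow_zero]
    exact ENNReal.mul_ne_top (by simp) (ne_top_of_le_ne_top (by simp) (rowNorm_id_le hR hw))
  have h1 : f 1 ≠ ∞ := by
    simp only [hf, pow_one]
    exact ENNReal.mul_ne_top (by simp) hBw
  set s : ℝ≥0∞ := (u : ℝ≥0∞)⁻¹ with hs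
  have hu0 : (u : ℝ≥0∞) ≠ 0 := by simpa using (zero_lt_one.trans hu1).ne'
  have hq : (u : ℝ≥0∞) ^ (2 * D) * ‖B‖ₑ ≤ s ^ 2 := by
    have h : (u : ℝ≥0∞) ^ (2 * D + 2) * ‖B‖ₑ ≤ 1 := by
      rw [enorm_eq_nnnorm]; exact_mod_cast huq
    calc (u : ℝ≥0∞) ^ (2 * D) * ‖B‖ₑ = (s * u) ^ 2 * ((u : ℝ≥0∞) ^ (2 * D) * ‖B‖ₑ) := by
          rw [ENNReal.inv_mul_cancel hu0 ENNReal.coe_ne_top, one_pow, one_mul]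
      _ = s ^ 2 * ((u : ℝ≥0∞) ^ (2 * D + 2) * ‖B‖ₑ) := by ring
      _ ≤ s ^ 2 * 1 := by gcongr
      _ = s ^ 2 := mul_one _
  have hone (n : ℕ) (hn : n ≠ 0) :
      rowNorm R 1 (B ^ n) ≤ (s ^ 2) ^ n * (C + rowNorm R w (B ^ n)) := by
    refine (rowNorm_one_le_growth hR hC (τ := (u ^ 2) ^ n)
      (one_le_pow₀ (one_le_pow₀ hu1.le)) (B ^ n)).trans ?_
    rw [mul_add]
    refine add_le_add ?_ ?_
    · calc C * (((u ^ 2) ^ n : ℝ≥0) : ℝ≥0∞) ^ D * ‖B ^ n‖ₑ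
          ≤ C * (((u ^ 2) ^ n : ℝ≥0) : ℝ≥0∞) ^ D * ‖B‖ₑ ^ n := by
            gcongr
            rw [enorm_eq_nnnorm, enorm_eq_nnnorm]
            exact_mod_cast nnnorm_pow_le' B (Nat.pos_of_ne_zero hn)
        _ = ((u : ℝ≥0∞) ^ (2 * D) * ‖B‖ₑ) ^ n * C := by push_cast; ring
        _ ≤ _ := by gcongr
    · gcongr
      simp [hs, ENNReal.inv_pow]
  obtain ⟨k, hk⟩ : ∃ k, f (2 ^ k) < 1 := by
    refine exists_lt_one_of_quadratic_bound (f := fun k => f (2 ^ k)) (c := 2 * (C + 1)) (s := s)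
      (by simpa using h1) (ENNReal.mul_ne_top (by simp) (by simp [hCtop])) ?_
      (by simpa [hs] using hu1) fun k hk => ?_
    · calc (1 : ℝ≥0∞) ≤ 2 * (0 + 1) := by norm_num
        _ ≤ _ := by gcongr; exact zero_le
    · set n := 2 ^ k with hn
      have hn0 : n ≠ 0 := by positivity
      have ha : rowNorm R w (B ^ n) ≤ f n := le_mul_of_one_le_left (zero_le) (by norm_num)
      calc f (2 ^ (k + 1)) = 2 * rowNorm R w (B ^ n * B ^ n) := by
            rw [← pow_add, pow_succ, mul_two]
        _ ≤ 2 * (rowNorm R w (B ^ n) * rowNorm R 1 (B ^ n)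
              + rowNorm R 1 (B ^ n) * rowNorm R w (B ^ n)) := by
            gcongr; exact rowNorm_mul_le hR hw _ _
        _ = 2 * f n * rowNorm R 1 (B ^ n) := by simp only [hf]; ring
        _ ≤ 2 * f n * ((s ^ 2) ^ n * (C * f n + f n)) := by
            gcongr
            refine (hone n hn0).trans ?_
            gcongr
            exact le_mul_of_one_le_right (zero_le) hk
        _ = _ := by ring
  have hsum := tsum_ne_top_of_submultiplicative h0 h1 hmul (pow_ne_zero k two_ne_zero) hk
  refine ne_top_of_le_ne_top hsum
    ((rowNorm_tsum_le (summable_geometric_of_norm_lt_one hB)).trans ?_)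
  exact ENNReal.tsum_le_tsum fun n => le_mul_of_one_le_left (zero_le) (by norm_num)

/-- For `T` bounded below, a small multiple of `T* T` is at distance less than one from the
identity. -/
lemma exists_norm_one_sub_smul_adjoint_mul_lt_one {T S : H →L[ℂ] H} (hST : S * T = 1) :
    ∃ c : ℝ, c ≠ 0 ∧ ‖1 - (c : ℂ) • (adjoint T * T)‖ < 1 := by
  set a := ‖T‖ ^ 2 + 1 with ha
  set b := ‖S‖ ^ 2 + 1 with hb
  have ha1 : 1 ≤ a := by nlinarith [sq_nonneg ‖T‖]
  have hb1 : 1 ≤ b := by nlinarith [sq_nonneg ‖S‖]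
  have ha0 : 0 < a := by linarith
  have hb0 : 0 < b := by linarith
  have hab : 1 / (a * b) ≤ 1 := by
    rw [div_le_one (by positivity)]; nlinarith
  refine ⟨1 / a, by positivity, ?_⟩
  have hx (x : H) : ‖(1 - ((1 / a : ℝ) : ℂ) • (adjoint T * T)) x‖
      ≤ √(1 - 1 / (a * b)) * ‖x‖ := by
    have e : (1 - ((1 / a : ℝ) : ℂ) • (adjoint T * T)) x
        = x - ((1 / a : ℝ) : ℂ) • adjoint T (T x) := by simp
    have h1 : ‖adjoint T (T x)‖ ^ 2 ≤ a * ‖T x‖ ^ 2 := by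
      have := (adjoint T).le_opNorm (T x)
      rw [LinearIsometryEquiv.norm_map] at this
      calc _ ≤ (‖T‖ * ‖T x‖) ^ 2 := by gcongr
        _ = ‖T‖ ^ 2 * ‖T x‖ ^ 2 := by ring
        _ ≤ _ := by gcongr; linarith
    have h2 : ‖x‖ ^ 2 ≤ b * ‖T x‖ ^ 2 := by
      have hxe : x = S (T x) := by
        simpa using (DFunLike.congr_fun hST x).symm
      calc ‖x‖ ^ 2 = ‖S (T x)‖ ^ 2 := by rw [← hxe]
        _ ≤ (‖S‖ * ‖T x‖) ^ 2 := by gcongr; exact S.le_opNorm _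
        _ = ‖S‖ ^ 2 * ‖T x‖ ^ 2 := by ring
        _ ≤ _ := by gcongr; linarith
    rw [e]
    refine (pow_le_pow_iff_left₀ (norm_nonneg _) (by positivity) two_ne_zero).1 ?_
    rw [mul_pow, Real.sq_sqrt (by linarith), norm_sub_sq (𝕜 := ℂ), inner_smul_right,
      adjoint_inner_right, inner_self_eq_norm_sq_to_K, norm_smul, mul_pow]
    have e1 : RCLike.re (((1 / a : ℝ) : ℂ) * ((‖T x‖ : ℂ)) ^ 2) = 1 / a * ‖T x‖ ^ 2 := by
      norm_cast
    have e2 : ‖((1 / a : ℝ) : ℂ)‖ ^ 2 = (1 / a) ^ 2 := by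
      rw [Complex.norm_real, Real.norm_eq_abs, sq_abs]
    have h3 : (1 / a) ^ 2 * ‖adjoint T (T x)‖ ^ 2 ≤ 1 / a * ‖T x‖ ^ 2 := by
      calc _ ≤ (1 / a) ^ 2 * (a * ‖T x‖ ^ 2) := by gcongr
        _ = _ := by field_simp
    have h4 : 1 / (a * b) * ‖x‖ ^ 2 ≤ 1 / a * ‖T x‖ ^ 2 := by
      calc _ ≤ 1 / (a * b) * (b * ‖T x‖ ^ 2) := by gcongr
        _ = _ := by field_simp
    erw [e1]
    rw [e2]
    linarith
  refine (opNorm_le_bound _ (Real.sqrt_nonneg _) hx).trans_lt ?_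
  rw [Real.sqrt_lt' one_pos]
  have : 0 < 1 / (a * b) := by positivity
  linarith

/-- **Wiener's lemma** for operators whose blocks have finite weighted row sums. -/
theorem rowNorm_inverse_ne_top (hR : IsBlockDecomposition R) (hw : IsPolyGrowthWeight w)
    {T S : H →L[ℂ] H} (hTS : T * S = 1) (hST : S * T = 1)
    (hT : rowNorm R w T ≠ ∞) (hT' : rowNorm R w (adjoint T) ≠ ∞) :
    rowNorm R w S ≠ ∞ := by
  obtain ⟨c, hc, hB⟩ := exists_norm_one_sub_smul_adjoint_mul_lt_one hST
  set B : H →L[ℂ] H := 1 - (c : ℂ) • (adjoint T * T) with hBdef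
  have hmul {X Y : H →L[ℂ] H} (hX : rowNorm R w X ≠ ∞) (hY : rowNorm R w Y ≠ ∞) :
      rowNorm R w (X * Y) ≠ ∞ :=
    ne_top_of_le_ne_top (ENNReal.mul_ne_top (by simp) (ENNReal.mul_ne_top hX hY))
      (rowNorm_mul_le_two hR hw X Y)
  have hsmul (z : ℂ) {X : H →L[ℂ] H} (hX : rowNorm R w X ≠ ∞) : rowNorm R w (z • X) ≠ ∞ := by
    rw [rowNorm_smul]
    exact ENNReal.mul_ne_top enorm_ne_top hX
  have hBw : rowNorm R w B ≠ ∞ := by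
    rw [hBdef, sub_eq_add_neg, ← neg_smul]
    exact ne_top_of_le_ne_top (ENNReal.add_ne_top.2
      ⟨ne_top_of_le_ne_top ENNReal.one_ne_top (rowNorm_id_le hR hw), hsmul _ (hmul hT' hT)⟩)
      (rowNorm_add_le _ _)
  have hS : S = (∑' n : ℕ, B ^ n) * ((c : ℂ) • adjoint T) := by
    have h := geom_series_mul_neg B hB
    have e : 1 - B = ((c : ℂ) • adjoint T) * T := by simp [hBdef]
    rw [e, ← mul_assoc] at h
    exact (left_inv_eq_right_inv h hTS).symm
  rw [hS]
  exact hmul (rowNorm_geom_series_ne_top hR hw hB hBw) (hsmul _ hT')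

end Blocks

/-! ### Slices of `ℓ²` and matrix representations -/

section Slices

open ContinuousLinearMap

variable {ι J K : Type*}

/-- Composition with an embedding of index sets. -/
def restrictL (g : K ↪ J) : L2 J →L[ℂ] L2 K :=
  LinearMap.mkContinuous
    { toFun := fun c => ⟨fun k => (c : ∀ _ : J, ℂ) (g k), by
        have h := (memℓp_gen_iff (by norm_num)).1 (lp.memℓp c)
        exact (memℓp_gen_iff (by norm_num)).2 (h.comp_injective g.injective)⟩
      map_add' := fun _ _ => rfl
      map_smul' := fun _ _ => rfl }
    1 fun c => by
      rw [one_mul]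
      refine lp.norm_le_of_forall_sum_le (by norm_num) (norm_nonneg _) fun s => ?_
      have h := lp.sum_rpow_le_norm_rpow (p := 2) (by norm_num) c (s.map g)
      rwa [Finset.sum_map] at h

@[simp]
lemma restrictL_apply (g : K ↪ J) (c : L2 J) (k : K) :
    (restrictL g c : ∀ _ : K, ℂ) k = (c : ∀ _ : J, ℂ) (g k) := rfl

lemma adjoint_restrictL_single [DecidableEq J] [DecidableEq K] (g : K ↪ J) (k : K) (a : ℂ) :
    adjoint (restrictL g) (lp.single 2 k a) = (lp.single 2 (g k) a : L2 J) := by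
  refine ext_inner_left ℂ fun v => ?_
  rw [adjoint_inner_right, lp.inner_single_right, lp.inner_single_right, restrictL_apply]

lemma L2_apply_eq_inner [DecidableEq J] (c : L2 J) (p : J) :
    (c : ∀ _ : J, ℂ) p = inner ℂ (lp.single 2 p (1 : ℂ)) c := by
  rw [lp.inner_single_left]
  simp

lemma adjoint_restrictL_apply (g : K ↪ J) (c : L2 K) (k : K) :
    (adjoint (restrictL g) c : ∀ _ : J, ℂ) (g k) = (c : ∀ _ : K, ℂ) k := by
  classical
  rw [L2_apply_eq_inner, adjoint_inner_right, L2_apply_eq_inner c k]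
  congr 1
  ext l
  simp [Pi.single_apply]

lemma adjoint_restrictL_apply_of_notMem (g : K ↪ J) (c : L2 K) {p : J} (hp : p ∉ Set.range g) :
    (adjoint (restrictL g) c : ∀ _ : J, ℂ) p = 0 := by
  classical
  rw [L2_apply_eq_inner, adjoint_inner_right]
  have : restrictL g (lp.single 2 p (1 : ℂ)) = 0 := by
    ext l
    have hl : g l ≠ p := fun h => hp ⟨l, h⟩
    simp [hl]
  rw [this, inner_zero_left]

/-- The inclusion of the `i`-th slice for an index set identified with a product. -/
def sliceEmb (φ : ι × K ≃ J) (i : ι) : K ↪ J :=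
  ⟨fun k => φ (i, k), fun k l h => by simpa using h⟩

lemma isBlockDecomposition_restrictL (φ : ι × K ≃ J) :
    IsBlockDecomposition fun i => restrictL (sliceEmb φ i) where
  enorm_le_one i := by
    rw [← ofReal_norm]
    exact ENNReal.ofReal_le_one.2 (LinearMap.mkContinuous_norm_le _ zero_le_one _)
  comp_adjoint_of_ne i j hij := by
    ext c k
    refine adjoint_restrictL_apply_of_notMem _ c ?_
    rintro ⟨l, hl⟩
    exact hij (Prod.ext_iff.1 (φ.injective hl)).1.symm
  hasSum x := by
    classical
    have h := (φ.hasSum_iff).2 (lp.hasSum_single (p := 2) (by simp) x)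
    refine h.prod_fiberwise fun i => ?_
    have h' := (lp.hasSum_single (p := 2) (by simp) (restrictL (sliceEmb φ i) x)).mapL
      (adjoint (restrictL (sliceEmb φ i)))
    simp_rw [adjoint_restrictL_single] at h'
    exact h'

lemma Represents.block {M : J → J → ℂ} {T : L2 J →L[ℂ] L2 J} (h : Represents M T)
    (φ : ι × K ≃ J) (i j : ι) :
    Represents (fun k l => M (φ (i, k)) (φ (j, l)))
      (block (fun i => restrictL (sliceEmb φ i)) T i j) := by
  intro c k
  have h1 := h (adjoint (restrictL (sliceEmb φ j)) c) (φ (i, k))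
  rw [← (sliceEmb φ j).injective.hasSum_iff fun p hp => by
    rw [adjoint_restrictL_apply_of_notMem _ c hp, mul_zero]] at h1
  refine h1.congr_fun ?_
  intro l
  simp only [Function.comp, adjoint_restrictL_apply]
  rfl

lemma Represents.unique {M : J → J → ℂ} {T S : L2 J →L[ℂ] L2 J} (hT : Represents M T)
    (hS : Represents M S) : T = S := by
  ext c k
  exact (hT c k).unique (hS c k)

lemma Represents.opNorm2_eq {M : J → J → ℂ} {T : L2 J →L[ℂ] L2 J} (hT : Represents M T) :
    opNorm2 M = ‖T‖ := by
  have hb : Bounded2 M := ⟨T, hT⟩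
  rw [opNorm2, dif_pos hb, hb.choose_spec.unique hT]

lemma represents_entries [DecidableEq J] (T : L2 J →L[ℂ] L2 J) :
    Represents (fun p q => (T (lp.single 2 q (1 : ℂ)) : ∀ _ : J, ℂ) p) T := by
  intro c p
  have h := ((lp.hasSum_single (p := 2) (by simp) c).mapL T).mapL
    (innerSL ℂ (lp.single 2 p (1 : ℂ) : L2 J))
  simp only [innerSL_apply_apply, ← L2_apply_eq_inner] at h
  refine h.congr_fun fun q => ?_
  have : (lp.single 2 q ((c : ∀ _ : J, ℂ) q) : L2 J)
      = (c : ∀ _ : J, ℂ) q • lp.single 2 q (1 : ℂ) := by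
    rw [← lp.single_smul]; simp
  rw [this, map_smul, lp.coeFn_smul, Pi.smul_apply, smul_eq_mul, mul_comm]

end Slices

/-! ### The polynomial weight on a relatively separated set -/

section Weight

open scoped ENNReal NNReal
open ContinuousLinearMap

variable {d : ℕ} {I : Set (EuclideanSpace ℝ (Fin d))}

/-- The weight `(1 + |i - j|)^δ`. -/
def polyWeight (I : Set (EuclideanSpace ℝ (Fin d))) (δ : ℝ) (i j : I) : ℝ≥0∞ :=
  ENNReal.ofReal ((1 + ‖(i : EuclideanSpace ℝ (Fin d)) - j‖) ^ δ)

lemma RelSeparated.exists_encard_le (hI : RelSeparated I) :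
    ∃ N : ℕ, ∀ (x : EuclideanSpace ℝ (Fin d)) (m : ℕ),
      (I ∩ {y | ‖x - y‖ ≤ m}).encard ≤ ((2 * m + 1) ^ d * N : ℕ) := by
  classical
  obtain ⟨N, hN⟩ := hI
  refine ⟨N, fun x m => ?_⟩
  let Z : Finset (Fin d → ℤ) := Fintype.piFinset fun _ => Finset.Icc (-(m : ℤ)) m
  let c (z : Fin d → ℤ) : EuclideanSpace ℝ (Fin d) := WithLp.toLp 2 fun t => x t + z t
  let Q (z : Fin d → ℤ) : Set (EuclideanSpace ℝ (Fin d)) :=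
    I ∩ {y | ∀ t : Fin d, y t ∈ Set.Icc (c z t) (c z t + 1)}
  have hcover : I ∩ {y | ‖x - y‖ ≤ m} ⊆ ⋃ z : Z, Q z := by
    rintro y ⟨hyI, hy⟩
    have hyt (t : Fin d) : |y t - x t| ≤ m := by
      have := (PiLp.norm_apply_le (x - y) t).trans hy
      rwa [PiLp.sub_apply, norm_sub_rev, Real.norm_eq_abs] at this
    refine Set.mem_iUnion.2 ⟨⟨fun t => ⌊y t - x t⌋, ?_⟩, hyI, fun t => ?_⟩
    · refine Fintype.mem_piFinset.2 fun t => Finset.mem_Icc.2 ⟨?_, ?_⟩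
      · rw [Int.le_floor]; push_cast; exact (abs_le.1 (hyt t)).1
      · have h : (⌊y t - x t⌋ : ℝ) ≤ m := (Int.floor_le _).trans (abs_le.1 (hyt t)).2
        exact_mod_cast h
    · have h1 := Int.floor_le (y t - x t)
      have h2 := (Int.lt_floor_add_one (y t - x t)).le
      constructor <;> simp only [c] <;> linarith
  calc (I ∩ {y | ‖x - y‖ ≤ m}).encard ≤ (⋃ z : Z, Q z).encard := Set.encard_le_encard hcover
    _ ≤ ∑ z : Z, (Q z).encard := Set.encard_iUnion_le_of_fintype _
    _ ≤ ∑ _z : Z, (N : ℕ∞) := by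
        refine Finset.sum_le_sum fun z _ => ?_
        rw [← (hN (c z)).1.cast_ncard_eq]
        exact_mod_cast (hN (c z)).2
    _ = _ := by
        have hcard : Z.card = (2 * m + 1) ^ d := by
          simp only [Z, Fintype.card_piFinset, Int.card_Icc, Finset.prod_const, Finset.card_univ,
            Fintype.card_fin]
          congr 1
          omega
        simp [hcard]

lemma isPolyGrowthWeight_polyWeight (hI : RelSeparated I) {δ : ℝ} (hδ : δ ∈ Set.Ioc (0 : ℝ) 1) :
    IsPolyGrowthWeight (polyWeight I δ) where
  self i := by simp [polyWeight]
  one_le i j := by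
    rw [polyWeight, ENNReal.one_le_ofReal]
    exact Real.one_le_rpow (by simp) hδ.1.le
  symm i j := by rw [polyWeight, polyWeight, norm_sub_rev]
  le_add i m j := by
    rw [polyWeight, polyWeight, polyWeight, ← ENNReal.ofReal_add (by positivity) (by positivity)]
    refine ENNReal.ofReal_le_ofReal ?_
    refine le_trans ?_ (Real.rpow_add_le_add_rpow (by positivity) (by positivity) hδ.1.le hδ.2)
    refine Real.rpow_le_rpow (by positivity) ?_ hδ.1.le
    have := norm_sub_le_norm_sub_add_norm_sub (i : EuclideanSpace ℝ (Fin d)) m j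
    linarith
  growth := by
    obtain ⟨N, hN⟩ := hI.exists_encard_le
    obtain ⟨p, hp⟩ := exists_nat_ge (1 / δ)
    refine ⟨5 ^ d * N, ENNReal.mul_ne_top (by simp) (by simp), p * d, fun τ hτ i => ?_⟩
    set m := ⌈(τ : ℝ) ^ p⌉₊ with hm
    have hτ1 : (1 : ℝ) ≤ τ := by exact_mod_cast hτ
    have hτp : (1 : ℝ) ≤ (τ : ℝ) ^ p := one_le_pow₀ hτ1
    have hsub : (Subtype.val '' {j : I | polyWeight I δ i j ≤ τ})
        ⊆ I ∩ {y | ‖(i : EuclideanSpace ℝ (Fin d)) - y‖ ≤ m} := by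
      rintro _ ⟨j, hj, rfl⟩
      refine ⟨j.2, ?_⟩
      have h1 : (1 + ‖(i : EuclideanSpace ℝ (Fin d)) - j‖) ^ δ ≤ τ := by
        rw [Set.mem_ofPred_eq, polyWeight] at hj
        simpa using (ENNReal.ofReal_le_iff_le_toReal ENNReal.coe_ne_top).1 hj
      have h2 : 1 + ‖(i : EuclideanSpace ℝ (Fin d)) - j‖ ≤ (τ : ℝ) ^ (1 / δ) := by
        rw [one_div]
        exact (Real.le_rpow_inv_iff_of_pos (by positivity) (by positivity) hδ.1).2 h1
      have h3 : (τ : ℝ) ^ (1 / δ) ≤ (τ : ℝ) ^ p := by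
        rw [← Real.rpow_natCast]
        exact Real.rpow_le_rpow_of_exponent_le hτ1 hp
      have h4 : (τ : ℝ) ^ p ≤ m := Nat.le_ceil _
      rw [Set.mem_ofPred_eq]
      linarith
    have hcard : {j : I | polyWeight I δ i j ≤ τ}.encard ≤ ((2 * m + 1) ^ d * N : ℕ) := by
      rw [← Subtype.val_injective.encard_image]
      exact (Set.encard_le_encard hsub).trans (hN i m)
    have hm5 : ((2 * m + 1 : ℕ) : ℝ≥0∞) ≤ 5 * (τ : ℝ≥0∞) ^ p := by
      have h : ((2 * m + 1 : ℕ) : ℝ) ≤ 5 * (τ : ℝ) ^ p := by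
        have := (Nat.ceil_lt_add_one (zero_le_one.trans hτp)).le
        push_cast
        linarith
      exact_mod_cast h
    calc ({j : I | polyWeight I δ i j ≤ τ}.encard : ℝ≥0∞)
        ≤ (((2 * m + 1) ^ d * N : ℕ) : ℝ≥0∞) := by
          exact_mod_cast ENat.toENNReal_mono hcard
      _ = ((2 * m + 1 : ℕ) : ℝ≥0∞) ^ d * N := by push_cast; ring
      _ ≤ (5 * (τ : ℝ≥0∞) ^ p) ^ d * N := by gcongr
      _ = _ := by rw [mul_pow, ← pow_mul]; ring

lemma iSup_tsum_ofReal_ne_top_iff {α β : Type*} {f : α → β → ℝ} (hf : ∀ i j, 0 ≤ f i j) :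
    ⨆ i, ∑' j, ENNReal.ofReal (f i j) ≠ ∞ ↔
      (∀ i, Summable (f i)) ∧ ∃ C : ℝ, ∀ i, ∑' j, f i j ≤ C := by
  constructor
  · intro h
    have hi (i : α) : ∑' j, ENNReal.ofReal (f i j) ≤ ⨆ i, ∑' j, ENNReal.ofReal (f i j) :=
      le_iSup (fun i => ∑' j, ENNReal.ofReal (f i j)) i
    have hs (i : α) : Summable (f i) := by
      have := ENNReal.summable_toReal (ne_top_of_le_ne_top h (hi i))
      simpa [ENNReal.toReal_ofReal (hf i _)] using this
    refine ⟨hs, (⨆ i, ∑' j, ENNReal.ofReal (f i j)).toReal, fun i => ?_⟩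
    rw [← ENNReal.ofReal_le_iff_le_toReal h, ENNReal.ofReal_tsum_of_nonneg (hf i) (hs i)]
    exact hi i
  · rintro ⟨hs, C, hC⟩
    refine ne_top_of_le_ne_top (b := ENNReal.ofReal C) ENNReal.ofReal_ne_top (iSup_le fun i => ?_)
    rw [← ENNReal.ofReal_tsum_of_nonneg (hf i) (hs i)]
    exact ENNReal.ofReal_le_ofReal (hC i)

lemma norm_block_mem_schurSet_iff {H K : Type*} [NormedAddCommGroup H] [InnerProductSpace ℂ H]
    [CompleteSpace H] [NormedAddCommGroup K] [InnerProductSpace ℂ K] [CompleteSpace K]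
    (R : I → H →L[ℂ] K) (δ : ℝ) (T : H →L[ℂ] H) :
    (fun i j => (‖block R T i j‖ : ℂ)) ∈ SchurSet I δ ↔
      rowNorm R (polyWeight I δ) T ≠ ∞ ∧ rowNorm R (polyWeight I δ) (adjoint T) ≠ ∞ := by
  have e (X : H →L[ℂ] H) : rowNorm R (polyWeight I δ) X = ⨆ i : I, ∑' j : I, ENNReal.ofReal
      (‖block R X i j‖ * (1 + ‖(i : EuclideanSpace ℝ (Fin d)) - j‖) ^ δ) := by
    simp only [rowNorm, polyWeight, ENNReal.ofReal_mul (norm_nonneg _), ofReal_norm]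
  have e' : rowNorm R (polyWeight I δ) (adjoint T) = ⨆ j : I, ∑' i : I, ENNReal.ofReal
      (‖block R T i j‖ * (1 + ‖(i : EuclideanSpace ℝ (Fin d)) - j‖) ^ δ) := by
    rw [e]
    congr! 5 with j i
    rw [block_adjoint, LinearIsometryEquiv.norm_map, norm_sub_rev]
  rw [e, e', iSup_tsum_ofReal_ne_top_iff fun i j => by positivity,
    iSup_tsum_ofReal_ne_top_iff fun j i => by positivity]
  simp only [SchurSet, Set.mem_ofPred_eq, Complex.norm_real, norm_norm]
  constructor
  · rintro ⟨h1, h2, C, h3, h4⟩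
    exact ⟨⟨h1, C, h3⟩, h2, C, h4⟩
  · rintro ⟨⟨h1, C, h3⟩, h2, C', h4⟩
    exact ⟨h1, h2, max C C', fun i => (h3 i).trans (le_max_left _ _),
      fun j => (h4 j).trans (le_max_right _ _)⟩

/-- Inverse-closedness of the operator-valued weighted Schur algebra. -/
theorem opNorm2_slices_mem_schurSet_of_inverse (hI : RelSeparated I) {δ : ℝ}
    (hδ : δ ∈ Set.Ioc (0 : ℝ) 1) {J K : Type*} (φ : I × K ≃ J) {M N : J → J → ℂ}
    {T S : L2 J →L[ℂ] L2 J} (hM : Represents M T) (hN : Represents N S)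
    (hTS : T * S = 1) (hST : S * T = 1)
    (h : (fun i j => (opNorm2 fun k l => M (φ (i, k)) (φ (j, l)) : ℂ)) ∈ SchurSet I δ) :
    (fun i j => (opNorm2 fun k l => N (φ (i, k)) (φ (j, l)) : ℂ)) ∈ SchurSet I δ := by
  have hR := isBlockDecomposition_restrictL φ
  have hw := isPolyGrowthWeight_polyWeight hI hδ
  simp only [fun i j => (hM.block φ i j).opNorm2_eq] at h
  simp only [fun i j => (hN.block φ i j).opNorm2_eq]
  rw [norm_block_mem_schurSet_iff] at h ⊢
  have hTS' : adjoint T * adjoint S = 1 := by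
    rw [← star_eq_adjoint, ← star_eq_adjoint, ← star_mul, hST, star_one]
  have hST' : adjoint S * adjoint T = 1 := by
    rw [← star_eq_adjoint, ← star_eq_adjoint, ← star_mul, hTS, star_one]
  exact ⟨rowNorm_inverse_ne_top hR hw hTS hST h.1 h.2,
    rowNorm_inverse_ne_top hR hw hTS' hST' h.2 (by rw [adjoint_adjoint]; exact h.1)⟩

end Weight

/-- the tensor algebra built from two weighted Schur algebras is inverse-closed. -/
theorem statement2 {d : ℕ} (hd : 1 ≤ d)
    (I₁ I₂ : Set (EuclideanSpace ℝ (Fin d)))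
    (hI₁ : RelSeparated I₁) (hI₂ : RelSeparated I₂)
    (δ₁ δ₂ : ℝ) (hδ₁ : δ₁ ∈ Set.Ioc (0 : ℝ) 1) (hδ₂ : δ₂ ∈ Set.Ioc (0 : ℝ) 1) :
    InverseClosed {A : Tensor ↥I₁ ↥I₂ |
      MemT1 (SchurSet I₁ δ₁) A ∧ MemT2 (SchurSet I₂ δ₂) A} := by
  rintro A ⟨⟨-, h₁⟩, -, h₂⟩ T S hT hTS hST
  have hS : Represents (toMatrix (entryTensor S)) S := by
    let _ : DecidableEq (I₁ × I₂) := Classical.decEq _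
    exact represents_entries S
  have m₁ := opNorm2_slices_mem_schurSet_of_inverse hI₁ hδ₁ (Equiv.refl (I₁ × I₂)) hT hS hTS hST h₁
  have m₂ := opNorm2_slices_mem_schurSet_of_inverse hI₂ hδ₂ (Equiv.prodComm I₂ I₁) hT hS hTS hST h₂
  generalize entryTensor S = B at hS m₁ m₂ ⊢
  exact ⟨⟨fun i j => ⟨_, hS.block (Equiv.refl (I₁ × I₂)) i j⟩, m₁⟩,
    fun k l => ⟨_, hS.block (Equiv.prodComm I₂ I₁) k l⟩, m₂⟩

end PaperTensor
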